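/- Error-function identity for n=2 with collinear splitting: for vectors v₁, v₂ spanning a positive definite 2-plane in ℝᵈ and any x ∈ ℝᵈ, one has Φ₂ᴱ(v₁, v₁+v₂; x) + Φ₂ᴱ(v₁+v₂, v₂; x) − Φ₂ᴱ(v₁, v₂; x) = 1. -/

import Mathlib

open MeasureTheory Matrix
open scoped Classical

/-- The sign function with the convention `sgn 0 = 0`. -/
noncomputable def sgn (x : ℝ) : ℝ := if 0 < x then 1 else if x < 0 then -1 else 0

/-- The indicator function of `0`. -/
noncomputable def delta (x : ℝ) : ℝ := if x = 0 then 1 else 0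

/-- The boosted generalized error function `Φₙᴱ({vᵢ};x)`, in its integral representation:
with `X` the Gram matrix `Xᵢⱼ = vᵢ·G·vⱼ` of the vectors `vᵢ` with respect to the bilinear
form given by `G`,
`Φₙᴱ({vᵢ};x) = (det X)^{−1/2} ∫ e^{−π (c−u)ᵀ X⁻¹ (c−u)} ∏ᵢ sgn(uᵢ) du`,
where `cᵢ = vᵢ·G·x`.  For the empty family this equals `1` (the convention `Φ₀ᴱ = 1`). -/
noncomputable def PhiE {d : ℕ} (G : Matrix (Fin d) (Fin d) ℝ)
    {ι : Type} [Fintype ι] (v : ι → Fin d → ℝ) (x : Fin d → ℝ) : ℝ :=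
  (Matrix.of fun i j : ι => v i ⬝ᵥ G.mulVec (v j)).det ^ (-(1:ℝ)/2) *
    ∫ u : ι → ℝ,
      Real.exp (-Real.pi *
        (((fun i => v i ⬝ᵥ G.mulVec x) - u) ⬝ᵥ
          (Matrix.of fun i j : ι => v i ⬝ᵥ G.mulVec (v j))⁻¹.mulVec
            ((fun i => v i ⬝ᵥ G.mulVec x) - u))) *
      ∏ i, sgn (u i)

section

variable {ι : Type} [Fintype ι]

theorem exp_neg_pi_mul_dotProduct_self (u : ι → ℝ) :
    Real.exp (-Real.pi * (u ⬝ᵥ u)) = ∏ i, Real.exp (-Real.pi * u i ^ 2) := by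
  rw [← Real.exp_sum, dotProduct, Finset.mul_sum]
  simp only [sq]

theorem integrable_exp_neg_pi_mul_dotProduct_self :
    Integrable fun u : ι → ℝ => Real.exp (-Real.pi * (u ⬝ᵥ u)) := by
  simp only [exp_neg_pi_mul_dotProduct_self]
  exact Integrable.fintype_prod (f := fun _ (t : ℝ) => Real.exp (-Real.pi * t ^ 2))
    fun _ => integrable_exp_neg_mul_sq Real.pi_pos

theorem integral_exp_neg_pi_mul_dotProduct_self :
    ∫ u : ι → ℝ, Real.exp (-Real.pi * (u ⬝ᵥ u)) = 1 := by
  simp only [exp_neg_pi_mul_dotProduct_self]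
  rw [integral_fintype_prod_volume_eq_pow (fun t : ℝ => Real.exp (-Real.pi * t ^ 2)),
    integral_gaussian, div_self Real.pi_ne_zero, Real.sqrt_one, one_pow]

theorem dotProduct_transpose_mul_mulVec (B : Matrix ι ι ℝ) (w : ι → ℝ) :
    w ⬝ᵥ (Bᵀ * B) *ᵥ w = (B *ᵥ w) ⬝ᵥ (B *ᵥ w) := by
  rw [← Matrix.mulVec_mulVec, Matrix.dotProduct_mulVec, Matrix.vecMul_transpose]

theorem measurable_sgn : Measurable sgn :=
  Measurable.ite measurableSet_Ioi measurable_const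
    (Measurable.ite measurableSet_Iio measurable_const measurable_const)

theorem abs_sgn_le_one (t : ℝ) : |sgn t| ≤ 1 := by
  unfold sgn
  split_ifs <;> simp

theorem MeasureTheory.Integrable.mul_prod_sgn {f : (ι → ℝ) → ℝ} (hf : Integrable f)
    (A : Matrix ι ι ℝ) : Integrable fun u => f u * ∏ i, sgn ((A *ᵥ u) i) := by
  have hm : Measurable fun u : ι → ℝ => ∏ i, sgn ((A *ᵥ u) i) := by
    refine Finset.measurable_prod _ fun i _ => measurable_sgn.comp ?_
    exact (show Continuous fun u : ι → ℝ => (A *ᵥ u) i by fun_prop).measurable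
  refine hf.mul_bdd (c := 1) hm.aestronglyMeasurable (.of_forall fun u => ?_)
  rw [Real.norm_eq_abs, Finset.abs_prod]
  exact Finset.prod_le_one (fun _ _ => abs_nonneg _) fun _ _ => abs_sgn_le_one _

variable [DecidableEq ι]

theorem measurableEmbedding_mulVec {A : Matrix ι ι ℝ} (hA : A.det ≠ 0) :
    MeasurableEmbedding fun u : ι → ℝ => A *ᵥ u := by
  have hc : Continuous fun u : ι → ℝ => A *ᵥ u := by fun_prop
  refine hc.measurableEmbedding ?_
  exact Matrix.mulVec_injective_of_isUnit
    ((Matrix.isUnit_iff_isUnit_det A).2 (isUnit_iff_ne_zero.2 hA))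

theorem map_mulVec_volume {A : Matrix ι ι ℝ} (hA : A.det ≠ 0) :
    Measure.map (fun u : ι → ℝ => A *ᵥ u) volume =
      ENNReal.ofReal |A.det⁻¹| • (volume : Measure (ι → ℝ)) :=
  Real.map_matrix_volume_pi_eq_smul_volume_pi hA

theorem integral_comp_mulVec {A : Matrix ι ι ℝ} (hA : A.det ≠ 0) (f : (ι → ℝ) → ℝ) :
    ∫ u, f (A *ᵥ u) = |A.det|⁻¹ * ∫ u, f u := by
  rw [← (measurableEmbedding_mulVec hA).integral_map, map_mulVec_volume hA, integral_smul_measure,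
    ENNReal.toReal_ofReal (abs_nonneg _), abs_inv, smul_eq_mul]

theorem MeasureTheory.Integrable.comp_mulVec {A : Matrix ι ι ℝ} (hA : A.det ≠ 0)
    {f : (ι → ℝ) → ℝ} (hf : Integrable f) : Integrable fun u => f (A *ᵥ u) := by
  change Integrable (f ∘ fun u => A *ᵥ u)
  rw [← (measurableEmbedding_mulVec hA).integrable_map_iff, map_mulVec_volume hA]
  exact hf.smul_measure ENNReal.ofReal_ne_top

open scoped MatrixOrder Matrix.Norms.L2Operator in
theorem Matrix.PosDef.exists_inv_eq_transpose_mul {X : Matrix ι ι ℝ} (hX : X.PosDef) :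
    ∃ B : Matrix ι ι ℝ, B.det ≠ 0 ∧ X⁻¹ = Bᵀ * B ∧ X.det ^ (-(1 : ℝ) / 2) = |B.det| := by
  obtain ⟨B, hB⟩ := CStarAlgebra.nonneg_iff_eq_star_mul_self.1 hX.inv.posSemidef.nonneg
  rw [Matrix.star_eq_conjTranspose] at hB
  rw [Matrix.conjTranspose_eq_transpose_of_trivial] at hB
  have hdet : X.det⁻¹ = B.det ^ 2 := by
    rw [← Ring.inverse_eq_inv', ← Matrix.det_nonsing_inv, hB, Matrix.det_mul,
      Matrix.det_transpose, sq]
  refine ⟨B, fun h => ?_, hB, ?_⟩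
  · simp [h, hX.det_pos.ne'] at hdet
  · rw [neg_div, Real.rpow_neg hX.det_pos.le, ← Real.inv_rpow hX.det_pos.le, hdet,
      ← Real.sqrt_eq_rpow, Real.sqrt_sq_eq_abs]

theorem integrable_exp_neg_pi_mul_inv {X : Matrix ι ι ℝ} (hX : X.PosDef) (c : ι → ℝ) :
    Integrable fun u : ι → ℝ => Real.exp (-Real.pi * ((c - u) ⬝ᵥ X⁻¹ *ᵥ (c - u))) := by
  obtain ⟨B, hB, hXB, -⟩ := hX.exists_inv_eq_transpose_mul
  simp only [hXB, dotProduct_transpose_mul_mulVec]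
  exact (integrable_exp_neg_pi_mul_dotProduct_self.comp_mulVec hB).comp_sub_left c

theorem integral_exp_neg_pi_mul_inv {X : Matrix ι ι ℝ} (hX : X.PosDef) (c : ι → ℝ) :
    X.det ^ (-(1 : ℝ) / 2) *
      ∫ u : ι → ℝ, Real.exp (-Real.pi * ((c - u) ⬝ᵥ X⁻¹ *ᵥ (c - u))) = 1 := by
  obtain ⟨B, hB, hXB, hdet⟩ := hX.exists_inv_eq_transpose_mul
  simp only [hXB, hdet, dotProduct_transpose_mul_mulVec]
  rw [integral_sub_left_eq_self
      (fun u : ι → ℝ => Real.exp (-Real.pi * ((B *ᵥ u) ⬝ᵥ (B *ᵥ u)))) volume c,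
    integral_comp_mulVec hB fun u => Real.exp (-Real.pi * (u ⬝ᵥ u)),
    integral_exp_neg_pi_mul_dotProduct_self, mul_one, mul_inv_cancel₀ (abs_ne_zero.2 hB)]

theorem PhiE_matrix_mul {d : ℕ} (G : Matrix (Fin d) (Fin d) ℝ) {A : Matrix ι ι ℝ}
    (hA : A.det ≠ 0) (V : Matrix ι (Fin d) ℝ) (x : Fin d → ℝ) (hV : 0 ≤ (V * G * Vᵀ).det) :
    PhiE G (A * V) x = (V * G * Vᵀ).det ^ (-(1 : ℝ) / 2) *
      ∫ u : ι → ℝ, Real.exp (-Real.pi * ((V *ᵥ G *ᵥ x - u) ⬝ᵥ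
        (V * G * Vᵀ)⁻¹ *ᵥ (V *ᵥ G *ᵥ x - u))) * ∏ i, sgn ((A *ᵥ u) i) := by
  obtain rfl : ‹DecidableEq ι› = fun a b => Classical.propDecidable (a = b) :=
    Subsingleton.elim _ _
  have hgram : (Matrix.of fun i j : ι => (A * V) i ⬝ᵥ G *ᵥ (A * V) j) =
      A * (V * G * Vᵀ) * Aᵀ := by
    have : A * (V * G * Vᵀ) * Aᵀ = (A * V) * (G * (A * V)ᵀ) := by
      simp only [Matrix.transpose_mul, Matrix.mul_assoc]
    rw [this]
    rfl
  have hunit : IsUnit A.det := isUnit_iff_ne_zero.2 hA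
  have hc : (fun i => (A * V) i ⬝ᵥ G *ᵥ x) = A *ᵥ V *ᵥ G *ᵥ x := by
    rw [Matrix.mulVec_mulVec]
    rfl
  have hdet : (A * (V * G * Vᵀ) * Aᵀ).det ^ (-(1 : ℝ) / 2) =
      |A.det|⁻¹ * (V * G * Vᵀ).det ^ (-(1 : ℝ) / 2) := by
    rw [Matrix.det_mul, Matrix.det_mul, Matrix.det_transpose, mul_right_comm, ← sq,
      Real.mul_rpow (sq_nonneg _) hV, neg_div, Real.rpow_neg (sq_nonneg A.det),
      ← Real.sqrt_eq_rpow, Real.sqrt_sq_eq_abs]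
  have hquad (w : ι → ℝ) : (A *ᵥ w) ⬝ᵥ (A * (V * G * Vᵀ) * Aᵀ)⁻¹ *ᵥ A *ᵥ w =
      w ⬝ᵥ (V * G * Vᵀ)⁻¹ *ᵥ w := by
    have hleft : Aᵀ * (Aᵀ)⁻¹ = 1 := Matrix.mul_nonsing_inv _ (by rwa [Matrix.det_transpose])
    rw [Matrix.mul_inv_rev, Matrix.mul_inv_rev, Matrix.mulVec_mulVec, Matrix.mul_assoc,
      Matrix.mul_assoc, Matrix.nonsing_inv_mul _ hunit, Matrix.mul_one,
      ← Matrix.vecMul_transpose, ← Matrix.dotProduct_mulVec, Matrix.mulVec_mulVec,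
      ← Matrix.mul_assoc, hleft, Matrix.one_mul]
  unfold PhiE
  rw [hgram, hc, hdet, mul_comm |A.det|⁻¹, mul_assoc, ← integral_comp_mulVec hA]
  simp only [← Matrix.mulVec_sub, hquad]

end

theorem sgn_two_term_identity {a b : ℝ} (h : a ≠ 0 ∨ b ≠ 0) :
    sgn a * sgn (a + b) + sgn (a + b) * sgn b - sgn a * sgn b = 1 := by
  unfold sgn
  split_ifs <;> norm_num <;> grind

/-- Error-function identity for `n = 2` with collinear splitting: for vectors `v₁, v₂`
spanning a positive definite 2-plane in `ℝᵈ` (with respect to the bilinear form given by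
the symmetric matrix `G`) and any `x ∈ ℝᵈ`,
`Φ₂ᴱ(v₁, v₁+v₂; x) + Φ₂ᴱ(v₁+v₂, v₂; x) − Φ₂ᴱ(v₁, v₂; x) = 1`. -/
theorem PhiE_two_term_identity
    (d : ℕ) (G : Matrix (Fin d) (Fin d) ℝ) (hG : G.IsSymm)
    (v₁ v₂ x : Fin d → ℝ)
    (hpd : (Matrix.of fun i j : Fin 2 =>
      (![v₁, v₂] i) ⬝ᵥ G.mulVec (![v₁, v₂] j)).PosDef) :
    PhiE G ![v₁, v₁ + v₂] x + PhiE G ![v₁ + v₂, v₂] x - PhiE G ![v₁, v₂] x = 1 := by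
  set V : Matrix (Fin 2) (Fin d) ℝ := Matrix.of ![v₁, v₂] with hV
  have hgram : (Matrix.of fun i j : Fin 2 =>
      (![v₁, v₂] i) ⬝ᵥ G.mulVec (![v₁, v₂] j)) = V * G * Vᵀ := by
    rw [Matrix.mul_assoc]
    rfl
  rw [hgram] at hpd
  have h₁ : ![v₁, v₁ + v₂] = (!![1, 0; 1, 1] : Matrix (Fin 2) (Fin 2) ℝ) * V := by
    ext i j
    fin_cases i <;> simp [hV, Matrix.mul_apply]
  have h₂ : ![v₁ + v₂, v₂] = (!![1, 1; 0, 1] : Matrix (Fin 2) (Fin 2) ℝ) * V := by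
    ext i j
    fin_cases i <;> simp [hV, Matrix.mul_apply]
  have h₃ : ![v₁, v₂] = (1 : Matrix (Fin 2) (Fin 2) ℝ) * V := by
    rw [Matrix.one_mul]
    rfl
  have hint := integrable_exp_neg_pi_mul_inv hpd (V *ᵥ G *ᵥ x)
  rw [h₁, h₂, h₃, PhiE_matrix_mul G (by simp [Matrix.det_fin_two]) V x hpd.det_pos.le,
    PhiE_matrix_mul G (by simp [Matrix.det_fin_two]) V x hpd.det_pos.le,
    PhiE_matrix_mul G (by simp) V x hpd.det_pos.le, ← mul_add, ← mul_sub,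
    ← integral_add' (hint.mul_prod_sgn _) (hint.mul_prod_sgn _),
    ← integral_sub' ((hint.mul_prod_sgn _).add (hint.mul_prod_sgn _)) (hint.mul_prod_sgn _)]
  refine (congrArg _ (integral_congr_ae ?_)).trans
    (integral_exp_neg_pi_mul_inv hpd (V *ᵥ G *ᵥ x))
  filter_upwards [compl_mem_ae_iff.2 (measure_singleton (0 : Fin 2 → ℝ))] with u hu
  have hne : u 0 ≠ 0 ∨ u 1 ≠ 0 := by
    by_contra! h
    exact hu (by ext i; fin_cases i <;> simp [h.1, h.2])
  simp only [Pi.add_apply, Pi.sub_apply]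
  rw [← mul_add, ← mul_sub]
  simpa [Matrix.mulVec, dotProduct, Fin.sum_univ_two, Fin.prod_univ_two] using
    sgn_two_term_identity hne
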